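/- If a graph G has chromatic number at most k (k ≥ 1), then G admits an injective straight-line drawing in ℝ² in which every edge has Euclidean length greater than 1/2 and less than 2√k + 1; consequently the edge-length ratio of G is at most c₁√k + O(1) for an absolute constant c₁. -/

import Mathlib

/-- `Fin k` embeds into a square grid of points with coordinates at most `m`, where `m * m ≤ k`. -/
theorem exists_grid_embedding (k : ℕ) (hk : 1 ≤ k) :
    ∃ (m : ℕ) (f : Fin k → ℕ × ℕ), m * m ≤ k ∧ Function.Injective f ∧
      ∀ c, (f c).1 ≤ m ∧ (f c).2 ≤ m := by
  set m := Nat.sqrt (k - 1) with hm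
  have hle : m * m ≤ k - 1 := Nat.sqrt_le _
  have hlt : k - 1 < (m + 1) * (m + 1) := Nat.lt_succ_sqrt _
  refine ⟨m, fun c => (c.val % (m + 1), c.val / (m + 1)), by omega, ?_, fun c => ⟨?_, ?_⟩⟩
  · intro a b hab
    simp only [Prod.mk.injEq] at hab
    ext
    rw [← Nat.div_add_mod a.val (m + 1), ← Nat.div_add_mod b.val (m + 1), hab.1, hab.2]
  · exact Nat.lt_succ_iff.mp (Nat.mod_lt _ (Nat.succ_pos m))
  · apply Nat.lt_succ_iff.mp
    rw [Nat.div_lt_iff_lt_mul (Nat.succ_pos m)]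
    have := c.isLt
    simp only [Nat.succ_eq_add_one]
    omega

/-- A finite type embeds into the interval `[0, 1/2)`. -/
theorem exists_injective_lt_half (V : Type*) [Fintype V] :
    ∃ δ : V → ℝ, Function.Injective δ ∧ ∀ v, 0 ≤ δ v ∧ δ v < 1 / 2 := by
  have hn : (0 : ℝ) < 2 * (Fintype.card V + 1) := by positivity
  refine ⟨fun v => (Fintype.equivFin V v : ℕ) / (2 * (Fintype.card V + 1)), ?_, fun v =>
    ⟨by positivity, ?_⟩⟩
  · intro u v h
    have h' := (div_left_inj' hn.ne').mp h
    exact (Fintype.equivFin V).injective (Fin.ext (by exact_mod_cast h'))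
  · have h : ((Fintype.equivFin V v : ℕ) : ℝ) < Fintype.card V := by
      exact_mod_cast (Fintype.equivFin V v).isLt
    rw [div_lt_iff₀ hn]
    linarith

theorem one_le_abs_natCast_sub {a b : ℕ} (h : a ≠ b) : (1 : ℝ) ≤ |(a : ℝ) - b| := by
  have h' : (1 : ℤ) ≤ |(a : ℤ) - b| := Int.one_le_abs (by omega)
  exact_mod_cast h'

theorem abs_natCast_sub_le {a b m : ℕ} (ha : a ≤ m) (hb : b ≤ m) : |(a : ℝ) - b| ≤ m := by
  have ha' : (a : ℝ) ≤ m := by exact_mod_cast ha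
  have hb' : (b : ℝ) ≤ m := by exact_mod_cast hb
  rw [abs_le]
  constructor <;> linarith [Nat.cast_nonneg (α := ℝ) a, Nat.cast_nonneg (α := ℝ) b]

theorem stmt_10 {V : Type*} [Fintype V] (G : SimpleGraph V) (k : ℕ) (hk : 1 ≤ k)
    (hcol : G.Colorable k) :
    ∃ ρ : V → EuclideanSpace ℝ (Fin 2), Function.Injective ρ ∧
      ∀ u v, G.Adj u v →
        1 / 2 < dist (ρ u) (ρ v) ∧ dist (ρ u) (ρ v) < 2 * Real.sqrt k + 1 := by
  obtain ⟨C⟩ := hcol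
  obtain ⟨m, f, hm, hf, hfm⟩ := exists_grid_embedding k hk
  obtain ⟨δ, hδ, hδb⟩ := exists_injective_lt_half V
  have hdiff : ∀ u v, |δ u - δ v| < 1 / 2 := fun u v => by
    rw [abs_lt]
    constructor <;> linarith [(hδb u).1, (hδb v).1, (hδb u).2, (hδb v).2]
  refine ⟨fun v => !₂[((f (C v)).1 : ℝ) + δ v, ((f (C v)).2 : ℝ)], ?_, ?_⟩
  · intro u v h
    have hx : ((f (C u)).1 : ℝ) + δ u = (f (C v)).1 + δ v := by
      simpa using congrArg (fun p : EuclideanSpace ℝ (Fin 2) => p 0) h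
    have h1 : (f (C u)).1 = (f (C v)).1 := by
      by_contra hne
      have h2 := one_le_abs_natCast_sub hne
      rw [show ((f (C u)).1 : ℝ) - (f (C v)).1 = δ v - δ u by linarith] at h2
      linarith [hdiff v u]
    rw [h1] at hx
    exact hδ (by linarith)
  · intro u v huv
    have hne : f (C u) ≠ f (C v) := fun h => C.valid huv (hf h)
    have hdx := abs_natCast_sub_le (hfm (C u)).1 (hfm (C v)).1
    have hdy := abs_natCast_sub_le (hfm (C u)).2 (hfm (C v)).2
    have hmk : (m : ℝ) ≤ Real.sqrt k := Real.le_sqrt_of_sq_le (by rw [sq]; exact_mod_cast hm)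
    have hd := hdiff u v
    have hm0 : (0 : ℝ) ≤ m := m.cast_nonneg
    have hxy : (f (C u)).1 ≠ (f (C v)).1 ∨ (f (C u)).2 ≠ (f (C v)).2 := by
      by_contra! h
      exact hne (Prod.ext h.1 h.2)
    have hgrid : 1 ≤ |((f (C u)).1 : ℝ) - (f (C v)).1| ∨ 1 ≤ |((f (C u)).2 : ℝ) - (f (C v)).2| :=
      hxy.imp one_le_abs_natCast_sub one_le_abs_natCast_sub
    simp only [EuclideanSpace.dist_eq, Fin.sum_univ_two, Real.dist_eq, sq_abs,
      Matrix.cons_val_zero, Matrix.cons_val_one]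
    rw [add_sub_add_comm]
    generalize ((f (C u)).1 : ℝ) - (f (C v)).1 = x at *
    generalize ((f (C u)).2 : ℝ) - (f (C v)).2 = y at *
    generalize δ u - δ v = d at *
    constructor
    · apply Real.lt_sqrt_of_sq_lt
      rcases hgrid with h | h
      · have h1 : 1 / 2 < |x + d| := by
          have := abs_sub_abs_le_abs_sub x (-d)
          rw [abs_neg, sub_neg_eq_add] at this
          linarith
        have h2 := sq_abs (x + d)
        nlinarith [sq_nonneg y]
      · have h2 := sq_abs y
        nlinarith [sq_nonneg (x + d)]
    · have h1 : |x + d| ≤ m + 1 / 2 := (abs_add_le x d).trans (by linarith)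
      have h2 : (x + d) ^ 2 ≤ (m + 1 / 2) ^ 2 := sq_le_sq' (abs_le.mp h1).1 (abs_le.mp h1).2
      have h3 : y ^ 2 ≤ m ^ 2 := sq_le_sq' (abs_le.mp hdy).1 (abs_le.mp hdy).2
      have h4 : Real.sqrt ((x + d) ^ 2 + y ^ 2) < 2 * m + 1 := by
        rw [Real.sqrt_lt' (by positivity)]
        nlinarith
      linarith
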